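/- In Λ²H ⊗ Λ²H the following identity holds: s₁ = 3·(α₁∧β₁ + α₂∧β₂)^{⊗2} + ((2α₁+β₂)∧(β₁+α₂))^{⊗2} − ((α₁+β₁+α₂)∧(α₁+β₁+β₂))^{⊗2} + ((α₁−β₂)∧β₁)^{⊗2} + (α₁∧(β₁−α₂))^{⊗2} − 2·(α₁∧(β₁+α₂))^{⊗2} − 2·(α₂∧(α₁+β₂))^{⊗2} − (α₁∧(β₁+α₂+β₂))^{⊗2} + (α₂∧(α₁+β₁+β₂))^{⊗2} + ((α₁+β₁+α₂)∧β₂)^{⊗2} − ((α₁+α₂+β₂)∧β₁)^{⊗2} + (α₁∧(β₁+β₂))^{⊗2} − ((β₁+α₂)∧β₂)^{⊗2} + ((α₁+α₂)∧β₁)^{⊗2} − 7·(α₁∧β₁)^{⊗2} − 2·(α₂∧β₂)^{⊗2}. Moreover, for every pair (u,v) such that (u∧v)^{⊗2} appears on the right-hand side (including (u,v) = (α₁∧β₁+α₂∧β₂ read as the genus-2 symplectic sum term excluded; i.e. for each of the fifteen listed wedge pairs u∧v), one has ω(u,v) = 1. -/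

import Mathlib

/-!
STATEMENT 11: For `H` free abelian on `α₁,β₁,α₂,β₂` with the standard symplectic form `ω`,
the element `s₁ = (α₁∧β₁)↔(α₂∧β₂) − (α₁∧α₂)↔(β₁∧β₂) + (α₁∧β₂)↔(β₁∧α₂)` of `Λ²H⊗Λ²H`
decomposes as the explicit combination of squares below, and each of the fifteen listed
wedge pairs `(u,v)` satisfies `ω(u,v) = 1`.
-/

open TensorProduct

set_option synthInstance.maxHeartbeats 1000000
set_option maxHeartbeats 1000000

/-- `H` is the free abelian group with basis `α₁, β₁, α₂, β₂` (coordinates `0,1,2,3`). -/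
abbrev Hg2 := Fin 4 → ℤ

def α₁ : Hg2 := ![1, 0, 0, 0]
def β₁ : Hg2 := ![0, 1, 0, 0]
def α₂ : Hg2 := ![0, 0, 1, 0]
def β₂ : Hg2 := ![0, 0, 0, 1]

/-- The alternating form `ω` with `ω(α₁,β₁) = ω(α₂,β₂) = 1` and all other pairings of
distinct basis vectors zero. -/
def om (u v : Hg2) : ℤ := u 0 * v 1 - u 1 * v 0 + u 2 * v 3 - u 3 * v 2

/-- The second exterior power `Λ²H` of `H` over `ℤ`. -/
abbrev Lambda2 : Submodule ℤ (ExteriorAlgebra ℤ Hg2) := ⋀[ℤ]^2 Hg2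

/-- The wedge product `a ∧ b` as an element of `Λ²H`. -/
noncomputable def w (a b : Hg2) : Lambda2 :=
  ⟨ExteriorAlgebra.ιMulti ℤ 2 ![a, b],
    ExteriorAlgebra.ιMulti_range ℤ 2 (Set.mem_range_self _)⟩

/-- `x ↔ y := x⊗y + y⊗x` in `Λ²H ⊗ Λ²H`. -/
noncomputable def hh (x y : Lambda2) : Lambda2 ⊗[ℤ] Lambda2 := x ⊗ₜ[ℤ] y + y ⊗ₜ[ℤ] x

/-- `x^{⊗2} := x ⊗ x` in `Λ²H ⊗ Λ²H`. -/
noncomputable def tsq (x : Lambda2) : Lambda2 ⊗[ℤ] Lambda2 := x ⊗ₜ[ℤ] x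

/-- `s₁ := (α₁∧β₁)↔(α₂∧β₂) − (α₁∧α₂)↔(β₁∧β₂) + (α₁∧β₂)↔(β₁∧α₂)`. -/
noncomputable def s₁ : Lambda2 ⊗[ℤ] Lambda2 :=
  hh (w α₁ β₁) (w α₂ β₂) - hh (w α₁ α₂) (w β₁ β₂) + hh (w α₁ β₂) (w β₁ α₂)

/-- `w` is the bilinear product of the generators in the exterior algebra. -/
theorem w_coe (a b : Hg2) :
    ((w a b : Lambda2) : ExteriorAlgebra ℤ Hg2) =
      ExteriorAlgebra.ι ℤ a * ExteriorAlgebra.ι ℤ b := by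
  simp [w, ExteriorAlgebra.ιMulti_apply]

theorem w_add_left (a b c : Hg2) : w (a + b) c = w a c + w b c := by
  apply Subtype.ext
  simp only [Submodule.coe_add, w_coe, map_add, add_mul]

theorem w_add_right (a b c : Hg2) : w a (b + c) = w a b + w a c := by
  apply Subtype.ext
  simp only [Submodule.coe_add, w_coe, map_add, mul_add]

theorem w_sub_left (a b c : Hg2) : w (a - b) c = w a c - w b c := by
  apply Subtype.ext
  simp only [AddSubgroupClass.coe_sub, w_coe, map_sub, sub_mul]

theorem w_sub_right (a b c : Hg2) : w a (b - c) = w a b - w a c := by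
  apply Subtype.ext
  simp only [AddSubgroupClass.coe_sub, w_coe, map_sub, mul_sub]

theorem w_self (a : Hg2) : w a a = 0 := by
  apply Subtype.ext
  simp [w_coe]

theorem w_swap (a b : Hg2) : w b a = -w a b := by
  have h := w_self (a + b)
  rw [w_add_left, w_add_right, w_add_right, w_self, w_self, zero_add, add_zero] at h
  exact eq_neg_of_add_eq_zero_right h

theorem statement11 :
    (s₁ =
      (3 : ℤ) • tsq (w α₁ β₁ + w α₂ β₂)
      + tsq (w ((2 : ℤ) • α₁ + β₂) (β₁ + α₂))
      - tsq (w (α₁ + β₁ + α₂) (α₁ + β₁ + β₂))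
      + tsq (w (α₁ - β₂) β₁)
      + tsq (w α₁ (β₁ - α₂))
      - (2 : ℤ) • tsq (w α₁ (β₁ + α₂))
      - (2 : ℤ) • tsq (w α₂ (α₁ + β₂))
      - tsq (w α₁ (β₁ + α₂ + β₂))
      + tsq (w α₂ (α₁ + β₁ + β₂))
      + tsq (w (α₁ + β₁ + α₂) β₂)
      - tsq (w (α₁ + α₂ + β₂) β₁)
      + tsq (w α₁ (β₁ + β₂))
      - tsq (w (β₁ + α₂) β₂)
      + tsq (w (α₁ + α₂) β₁)
      - (7 : ℤ) • tsq (w α₁ β₁)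
      - (2 : ℤ) • tsq (w α₂ β₂)) ∧
    om ((2 : ℤ) • α₁ + β₂) (β₁ + α₂) = 1 ∧
    om (α₁ + β₁ + α₂) (α₁ + β₁ + β₂) = 1 ∧
    om (α₁ - β₂) β₁ = 1 ∧
    om α₁ (β₁ - α₂) = 1 ∧
    om α₁ (β₁ + α₂) = 1 ∧
    om α₂ (α₁ + β₂) = 1 ∧
    om α₁ (β₁ + α₂ + β₂) = 1 ∧
    om α₂ (α₁ + β₁ + β₂) = 1 ∧
    om (α₁ + β₁ + α₂) β₂ = 1 ∧
    om (α₁ + α₂ + β₂) β₁ = 1 ∧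
    om α₁ (β₁ + β₂) = 1 ∧
    om (β₁ + α₂) β₂ = 1 ∧
    om (α₁ + α₂) β₁ = 1 ∧
    om α₁ β₁ = 1 ∧
    om α₂ β₂ = 1 := by
  refine ⟨?_, ?_⟩
  · simp only [s₁, two_smul ℤ α₁, w_add_left, w_add_right, w_sub_left, w_sub_right, w_self,
      w_swap α₁ β₁, w_swap α₁ α₂, w_swap α₁ β₂, w_swap β₁ α₂, w_swap β₁ β₂, w_swap α₂ β₂]
    generalize w α₁ β₁ = x₁
    generalize w α₁ α₂ = x₂
    generalize w α₁ β₂ = x₃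
    generalize w β₁ α₂ = x₄
    generalize w β₁ β₂ = x₅
    generalize w α₂ β₂ = x₆
    simp only [hh, tsq, TensorProduct.add_tmul, TensorProduct.tmul_add, TensorProduct.sub_tmul,
      TensorProduct.tmul_sub, TensorProduct.neg_tmul, TensorProduct.tmul_neg,
      TensorProduct.zero_tmul, TensorProduct.tmul_zero]
    module
  · simp [om, α₁, β₁, α₂, β₂]
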